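/- For all integers q ≥ 3 and l ≥ 2, ∫_0^1 P_l(t)^q dt = O((log l)/l²), i.e. there is a constant C (independent of q and l) with |∫_0^1 P_l(t)^q dt| ≤ C (log l)/l² for all q ≥ 3 and l ≥ 2. -/

import Mathlib

open Polynomial intervalIntegral

noncomputable def legendreP (l : ℕ) : Polynomial ℝ :=
  Polynomial.C (1 / (2 ^ l * (Nat.factorial l) : ℝ)) *
    (⇑Polynomial.derivative)^[l] ((Polynomial.X ^ 2 - 1) ^ l)

/-- The `(k + 1)`-st derivative of the first-order equation satisfied by `w = (X² - 1) ^ l`. -/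
lemma legendre_rodrigues_iterate (l k : ℕ) :
    ((X : ℝ[X]) ^ 2 - 1) * derivative^[k + 2] (((X : ℝ[X]) ^ 2 - 1) ^ l)
        + C (2 * (k + 1) : ℝ) * X * derivative^[k + 1] ((X ^ 2 - 1) ^ l)
        + C ((k + 1) * k : ℝ) * derivative^[k] ((X ^ 2 - 1) ^ l)
      = C (2 * l : ℝ) * (X * derivative^[k + 1] ((X ^ 2 - 1) ^ l)
        + C (k + 1 : ℝ) * derivative^[k] ((X ^ 2 - 1) ^ l)) := by
  induction k with
  | zero =>
    have h : ((X : ℝ[X]) ^ 2 - 1) * derivative (((X : ℝ[X]) ^ 2 - 1) ^ l)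
        = C (2 * l : ℝ) * (X * (X ^ 2 - 1) ^ l) := by
      cases l with
      | zero => simp
      | succ n => simp [derivative_pow]; ring
    have h' := congrArg derivative h
    simp only [derivative_mul, derivative_sub, derivative_X_pow, derivative_one, derivative_C,
      derivative_X] at h'
    simp only [Function.iterate_succ_apply', Function.iterate_zero, id]
    simp at h' ⊢
    linear_combination h'
  | succ k ih =>
    have h' := congrArg derivative ih
    simp only [derivative_mul, derivative_sub, derivative_add, derivative_X_pow, derivative_one,
      derivative_C, derivative_X, ← Function.iterate_succ_apply'] at h'
    have hC : (C 2 : ℝ[X]) = 2 := rfl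
    simp [hC] at h' ⊢
    linear_combination h'

/-- The Legendre differential equation. -/
lemma legendreP_ode (l : ℕ) (t : ℝ) :
    (1 - t ^ 2) * (derivative (derivative (legendreP l))).eval t
      = 2 * t * (derivative (legendreP l)).eval t - (l * (l + 1) : ℝ) * (legendreP l).eval t := by
  have h := congrArg (eval t) (legendre_rodrigues_iterate l l)
  simp only [legendreP, derivative_C_mul, ← Function.iterate_succ_apply', eval_mul, eval_add, eval_C,
    eval_X, eval_sub, eval_pow, eval_one] at h ⊢
  linear_combination (-(1 / (2 ^ l * (Nat.factorial l) : ℝ))) * h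

lemma legendreP_eval_one (l : ℕ) : (legendreP l).eval 1 = 1 := by
  have h := aeval_iterate_derivative_self (((X : ℝ[X]) ^ 2 - 1) ^ l) l (1 : ℝ)
    (p' := (X + 1) ^ l) (by simp [← mul_pow]; congr 1; ring)
  simp only [coe_aeval_eq_eval] at h
  rw [legendreP, eval_mul, h]
  simp
  field_simp
  norm_num

lemma legendre_coeff_sq_sub_one_pow (l k : ℕ) :
    (((X : ℝ[X]) ^ 2 - 1) ^ l).coeff (2 * k) = (-1) ^ (l - k) * (l.choose k : ℝ) := by
  have : ((X : ℝ[X]) ^ 2 - 1) ^ l = expand ℝ 2 ((X + C (-1)) ^ l) := by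
    simp [sub_eq_add_neg]
  rw [this, mul_comm 2 k, coeff_expand_mul (by norm_num), coeff_X_add_C_pow]

lemma legendre_coeff_sq_sub_one_pow_odd (l k : ℕ) :
    (((X : ℝ[X]) ^ 2 - 1) ^ l).coeff (2 * k + 1) = 0 := by
  have : ((X : ℝ[X]) ^ 2 - 1) ^ l = expand ℝ 2 ((X - C 1) ^ l) := by simp
  rw [this, coeff_expand (by norm_num), if_neg (by omega)]

lemma legendreP_eval_zero (l : ℕ) :
    (legendreP l).eval 0 = 1 / 2 ^ l * (((X : ℝ[X]) ^ 2 - 1) ^ l).coeff l := by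
  rw [← coeff_zero_eq_eval_zero, legendreP, coeff_C_mul, coeff_iterate_derivative]
  simp [Nat.descFactorial_self]
  field_simp

lemma legendreP_derivative_eval_zero (l : ℕ) :
    (derivative (legendreP l)).eval 0
      = (l + 1) / 2 ^ l * (((X : ℝ[X]) ^ 2 - 1) ^ l).coeff (l + 1) := by
  have h : (l + 1).descFactorial l = (l + 1) * l.factorial := by
    have h := Nat.factorial_mul_descFactorial (Nat.le_succ l)
    rwa [Nat.succ_eq_add_one, Nat.add_sub_cancel_left, Nat.factorial_one, one_mul,
      Nat.factorial_succ] at h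
  rw [← coeff_zero_eq_eval_zero, coeff_derivative, legendreP, coeff_C_mul, coeff_iterate_derivative,
    zero_add, add_comm 1 l, h]
  simp
  field_simp

lemma sq_centralBinom_mul_le (m : ℕ) :
    ((Nat.centralBinom m : ℝ)) ^ 2 * (2 * m + 1) ≤ 16 ^ m := by
  induction m with
  | zero => simp
  | succ m ih =>
    have h : ((m : ℝ) + 1) * Nat.centralBinom (m + 1) = 2 * (2 * m + 1) * Nat.centralBinom m := by
      exact_mod_cast Nat.succ_mul_centralBinom_succ m
    have hm : (0 : ℝ) < (m + 1) ^ 2 := by positivity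
    have key : ((m : ℝ) + 1) ^ 2 * ((Nat.centralBinom (m + 1) : ℝ) ^ 2 * (2 * (m + 1) + 1))
        ≤ (m + 1) ^ 2 * (16 ^ m * 16) := by
      calc ((m : ℝ) + 1) ^ 2 * ((Nat.centralBinom (m + 1) : ℝ) ^ 2 * (2 * (m + 1) + 1))
          = (((m : ℝ) + 1) * Nat.centralBinom (m + 1)) ^ 2 * (2 * (m + 1) + 1) := by ring
        _ = ((Nat.centralBinom m : ℝ) ^ 2 * (2 * m + 1)) * (4 * (2 * m + 1) * (2 * m + 3)) := by
            rw [h]; ring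
        _ ≤ 16 ^ m * (4 * (2 * m + 1) * (2 * m + 3)) := by gcongr
        _ ≤ 16 ^ m * (16 * (m + 1) ^ 2) := mul_le_mul_of_nonneg_left (by nlinarith) (by positivity)
        _ = _ := by ring
    push_cast
    rw [pow_succ (16 : ℝ) m]
    exact le_of_mul_le_mul_left key hm

lemma legendreP_energy_zero (l : ℕ) (hl : 1 ≤ l) :
    (legendreP l).eval 0 * (derivative (legendreP l)).eval 0 = 0 ∧
    (legendreP l).eval 0 ^ 2 + (derivative (legendreP l)).eval 0 ^ 2 / (l * (l + 1)) ≤ 1 / l := by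
  rw [legendreP_eval_zero, legendreP_derivative_eval_zero]
  have hsgn (n : ℕ) : ((-1 : ℝ) ^ n) ^ 2 = 1 := by rw [← pow_mul, mul_comm, pow_mul]; simp
  have h16 (m : ℕ) : (16 : ℝ) ^ m = (2 ^ (2 * m)) ^ 2 := by
    rw [← pow_mul, mul_comm (2 * m), ← mul_assoc, pow_mul]; norm_num
  obtain ⟨m, rfl | rfl⟩ := Nat.even_or_odd' l
  · rw [legendre_coeff_sq_sub_one_pow_odd, legendre_coeff_sq_sub_one_pow]
    refine ⟨by simp, ?_⟩
    have h := sq_centralBinom_mul_le m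
    rw [Nat.centralBinom, h16] at h
    have hm : (0 : ℝ) < m := by exact_mod_cast (by omega : 0 < m)
    rw [mul_pow, mul_pow, hsgn]
    push_cast
    simp only [mul_zero, ne_eq, OfNat.ofNat_ne_zero, not_false_eq_true, zero_pow, zero_div,
      add_zero, one_mul]
    rw [div_pow, one_pow, div_mul_eq_mul_div, one_mul, div_le_div_iff₀ (by positivity) (by positivity)]
    nlinarith [sq_nonneg (((2 * m).choose m : ℕ) : ℝ)]
  · rw [legendre_coeff_sq_sub_one_pow_odd, show 2 * m + 1 + 1 = 2 * (m + 1) by ring,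
      legendre_coeff_sq_sub_one_pow]
    refine ⟨by simp, ?_⟩
    have h := sq_centralBinom_mul_le (m + 1)
    have hc : Nat.centralBinom (m + 1) = 2 * (2 * m + 1).choose (m + 1) := by
      rw [Nat.centralBinom, show 2 * (m + 1) = 2 * m + 1 + 1 by ring, Nat.choose_succ_succ,
        Nat.choose_symm_half]; ring
    rw [hc, h16, show 2 * (m + 1) = 2 * m + 1 + 1 by ring, pow_succ (2 : ℝ) (2 * m + 1)] at h
    simp only [mul_pow, hsgn]
    push_cast at h ⊢
    set b : ℝ := (((2 * m + 1).choose (m + 1) : ℕ) : ℝ)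
    set w : ℝ := 2 ^ (2 * m + 1) with hw
    have hw0 : 0 < w := by positivity
    have hb : b ^ 2 * (2 * m + 3) ≤ w ^ 2 := by nlinarith
    have : ((2 * m + 1 + 1 : ℝ) / w) ^ 2 * (1 * b ^ 2) / ((2 * m + 1) * (2 * m + 1 + 1))
        = ((2 * m + 2) * b ^ 2) / ((2 * m + 1) * w ^ 2) := by
      field_simp; ring
    rw [this, zero_pow two_ne_zero, mul_zero, zero_add,
      div_le_div_iff₀ (by positivity) (by positivity)]
    have : (2 * m + 2) * b ^ 2 ≤ w ^ 2 := by nlinarith [sq_nonneg b]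
    nlinarith

/-- The energy of the Legendre equation increases on `[0, 1]` to its value `1` at `1`. -/
lemma legendreP_energy_le_one (l : ℕ) (hl : 1 ≤ l) {t : ℝ} (ht : t ∈ Set.Icc (0 : ℝ) 1) :
    (legendreP l).eval t ^ 2
      + (1 - t ^ 2) * (derivative (legendreP l)).eval t ^ 2 / (l * (l + 1)) ≤ 1 := by
  have hl0 : (0 : ℝ) < l := by exact_mod_cast hl
  have hd (x : ℝ) : HasDerivAt (fun t => (legendreP l).eval t ^ 2
      + (1 - t ^ 2) * (derivative (legendreP l)).eval t ^ 2 / (l * (l + 1)))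
      (2 * x * (derivative (legendreP l)).eval x ^ 2 / (l * (l + 1))) x := by
    have h := (((legendreP l).hasDerivAt x).pow 2).add (((((hasDerivAt_id x).pow 2).const_sub 1).mul
      (((derivative (legendreP l)).hasDerivAt x).pow 2)).div_const ((l : ℝ) * (l + 1)))
    refine h.congr_deriv ?_
    have ho := legendreP_ode l x
    simp
    field_simp
    linear_combination (derivative (legendreP l)).eval x * ho
  have hmono : MonotoneOn (fun t => (legendreP l).eval t ^ 2
      + (1 - t ^ 2) * (derivative (legendreP l)).eval t ^ 2 / (l * (l + 1)))
      (Set.Icc (0 : ℝ) 1) := by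
    refine monotoneOn_of_hasDerivWithinAt_nonneg (convex_Icc 0 1)
      (fun x _ => (hd x).continuousAt.continuousWithinAt) (fun x _ => (hd x).hasDerivWithinAt) ?_
    intro x hx
    rw [interior_Icc] at hx
    have := hx.1
    positivity
  have := hmono ht (Set.right_mem_Icc.2 zero_le_one) ht.2
  simpa [legendreP_eval_one] using this

/-- The amplitude of `√(sin θ) P_l(cos θ)` is monotone by Sonin's theorem, hence bounded by its
value at `t = 0`. -/
lemma legendreP_amplitude_le (l : ℕ) (hl : 1 ≤ l) {t : ℝ} (h0 : 0 ≤ t) (h1 : t < 1) :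
    √(1 - t ^ 2) * ((legendreP l).eval t ^ 2
      + ((1 - t ^ 2) * (derivative (legendreP l)).eval t - t / 2 * (legendreP l).eval t) ^ 2
        / ((1 - t ^ 2) * (l * (l + 1) + 1 / 4) + 1 / 4)) ≤ 1 / l := by
  have hl0 : (0 : ℝ) < l := by exact_mod_cast hl
  set f : ℝ → ℝ := fun t => √(1 - t ^ 2) * ((legendreP l).eval t ^ 2
      + ((1 - t ^ 2) * (derivative (legendreP l)).eval t - t / 2 * (legendreP l).eval t) ^ 2
        / ((1 - t ^ 2) * (l * (l + 1) + 1 / 4) + 1 / 4)) with hf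
  have hd (x : ℝ) (hx0 : 0 ≤ x) (hx1 : x < 1) : HasDerivAt f
      (-(x * ((1 - x ^ 2) * (derivative (legendreP l)).eval x - x / 2 * (legendreP l).eval x) ^ 2
        / (2 * ((1 - x ^ 2) * (l * (l + 1) + 1 / 4) + 1 / 4) ^ 2 * √(1 - x ^ 2)))) x := by
    have hs : 0 < 1 - x ^ 2 := by nlinarith
    have hR : 0 < (1 - x ^ 2) * ((l : ℝ) * (l + 1) + 1 / 4) + 1 / 4 := by positivity
    have hq : 0 < √(1 - x ^ 2) := Real.sqrt_pos.2 hs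
    have hq2 : √(1 - x ^ 2) ^ 2 = 1 - x ^ 2 := Real.sq_sqrt hs.le
    have h1 : HasDerivAt (fun t : ℝ => 1 - t ^ 2) (-(2 * x)) x := by
      simpa using (hasDerivAt_pow 2 x).const_sub 1
    have hp := (legendreP l).hasDerivAt x
    have hp' := (derivative (legendreP l)).hasDerivAt x
    have ha : HasDerivAt (fun t : ℝ => (1 - t ^ 2) * (derivative (legendreP l)).eval t
        - t / 2 * (legendreP l).eval t)
        (-(l * (l + 1) + 1 / 2 : ℝ) * (legendreP l).eval x
          - x / 2 * (derivative (legendreP l)).eval x) x := by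
      refine ((h1.mul hp').sub (((hasDerivAt_id x).div_const 2).mul hp)).congr_deriv ?_
      simp
      linear_combination legendreP_ode l x
    have hRd := (h1.mul_const ((l : ℝ) * (l + 1) + 1 / 4)).add_const (1 / 4)
    have h := (h1.sqrt hs.ne').mul ((hp.pow 2).add ((ha.pow 2).div hRd hR.ne'))
    refine h.congr_deriv ?_
    simp only [Pi.add_apply, Pi.pow_apply, Pi.div_apply]
    generalize (derivative (legendreP l)).eval x = d
    generalize (legendreP l).eval x = p
    generalize hν : (l : ℝ) * (l + 1) = ν at *
    generalize √(1 - x ^ 2) = w at *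
    rw [← hq2] at hR ⊢
    have hx : x ^ 2 = 1 - w ^ 2 := by linarith
    have hR' : w ^ 2 * (ν * 4 + 1) + 1 ≠ 0 := by linarith
    norm_num
    field_simp
    clear h hf ha hRd hR h1 hp hp'
    grind
  have hanti : AntitoneOn f (Set.Icc 0 t) := by
    refine antitoneOn_of_hasDerivWithinAt_nonpos (convex_Icc 0 t)
      (fun x hx => (hd x hx.1 (hx.2.trans_lt h1)).continuousAt.continuousWithinAt)
      (fun x hx => (hd x (interior_subset hx).1
        ((interior_subset hx).2.trans_lt h1)).hasDerivWithinAt) ?_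
    intro x hx
    have hx0 := (interior_subset hx).1
    have := (interior_subset hx).2
    have hs : 0 < 1 - x ^ 2 := by nlinarith
    rw [neg_nonpos]
    positivity
  refine (hanti (Set.left_mem_Icc.2 h0) (Set.right_mem_Icc.2 h0) h0).trans ?_
  refine le_trans ?_ (legendreP_energy_zero l hl).2
  simp only [hf]
  norm_num
  gcongr
  linarith

lemma legendreP_sq_mul_sqrt_le (l : ℕ) (hl : 1 ≤ l) {t : ℝ} (h0 : 0 ≤ t) (h1 : t < 1) :
    √(1 - t ^ 2) * (legendreP l).eval t ^ 2 ≤ 1 / l := by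
  have hs : 0 < 1 - t ^ 2 := by nlinarith
  refine le_trans ?_ (legendreP_amplitude_le l hl h0 h1)
  gcongr
  exact le_add_of_nonneg_right (by positivity)

lemma legendreP_derivative_sq_le (l : ℕ) (hl : 1 ≤ l) {t : ℝ} (h0 : 0 ≤ t) (h1 : t < 1)
    (ht : 1 ≤ (l * (l + 1) : ℝ) * (1 - t ^ 2)) :
    (derivative (legendreP l)).eval t ^ 2 * √(1 - t ^ 2) ^ 3 ≤ 16 * l := by
  have hl1 : (1 : ℝ) ≤ l := by exact_mod_cast hl
  have hs : 0 < 1 - t ^ 2 := by nlinarith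
  have hw : 0 < √(1 - t ^ 2) := Real.sqrt_pos.2 hs
  have hw2 : √(1 - t ^ 2) ^ 2 = 1 - t ^ 2 := Real.sq_sqrt hs.le
  have hA := legendreP_amplitude_le l hl h0 h1
  have hP := legendreP_sq_mul_sqrt_le l hl h0 h1
  rw [← hw2] at hA ht
  generalize (derivative (legendreP l)).eval t = d at *
  generalize (legendreP l).eval t = p at *
  rw [hw2] at hA
  generalize √(1 - t ^ 2) = w at *
  rw [← hw2] at hA
  have hR : 0 < w ^ 2 * ((l : ℝ) * (l + 1) + 1 / 4) + 1 / 4 := by positivity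
  set a := w ^ 2 * d - t / 2 * p with ha
  have ha2 : w * a ^ 2 ≤ (w ^ 2 * ((l : ℝ) * (l + 1) + 1 / 4) + 1 / 4) / l := by
    have : w * (a ^ 2 / (w ^ 2 * ((l : ℝ) * (l + 1) + 1 / 4) + 1 / 4)) ≤ 1 / l := by
      refine le_trans ?_ hA
      gcongr
      exact le_add_of_nonneg_left (sq_nonneg p)
    rw [← mul_div_assoc, div_le_div_iff₀ hR (by positivity)] at this
    rw [le_div_iff₀ (by positivity)]
    linarith
  have h3 : w * (w ^ 2 * d) ^ 2 ≤ 2 * (w * a ^ 2) + w * p ^ 2 / 2 := by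
    have h4 : (w ^ 2 * d) ^ 2 ≤ 2 * a ^ 2 + p ^ 2 / 2 := by
      have h5 : w ^ 2 * d = a + t / 2 * p := by rw [ha]; ring
      have h6 : t ^ 2 * p ^ 2 ≤ 1 * p ^ 2 := by gcongr; nlinarith
      rw [h5]
      nlinarith [sq_nonneg (a - t / 2 * p)]
    nlinarith
  have h7 : w * (w ^ 2 * d) ^ 2 ≤ 16 * l * w ^ 2 := by
    calc w * (w ^ 2 * d) ^ 2
        ≤ 2 * ((w ^ 2 * ((l : ℝ) * (l + 1) + 1 / 4) + 1 / 4) / l) + 1 / l / 2 := by linarith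
      _ = (2 * w ^ 2 * (l * (l + 1) + 1 / 4) + 1) / l := by field_simp; ring
      _ ≤ (8 * w ^ 2 * (l * (l + 1))) / l := by gcongr; nlinarith [sq_nonneg w]
      _ = 8 * w ^ 2 * (l + 1) := by field_simp
      _ ≤ _ := by nlinarith [sq_nonneg w]
  refine le_of_mul_le_mul_right ?_ (pow_pos hw 2)
  linarith

lemma integral_legendreP_pow_four_le (l : ℕ) (hl : 2 ≤ l) :
    ∫ t in (0 : ℝ)..1, (legendreP l).eval t ^ 4 ≤ (3 * Real.log l + 1) / (l : ℝ) ^ 2 := by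
  have hl2 : (2 : ℝ) ≤ l := by exact_mod_cast hl
  have hl1 : 1 ≤ l := by omega
  set Λ : ℝ := l * (l + 1) with hΛ
  have hΛ6 : l ^ 2 ≤ Λ := by nlinarith
  have hΛ1 : 4 ≤ Λ := by nlinarith
  have hinv : 0 < 1 / Λ := by positivity
  have hinv1 : 1 / Λ ≤ 1 / 4 := by gcongr
  have hcont : Continuous fun t : ℝ => (legendreP l).eval t ^ 4 := by fun_prop
  have hA : ∫ t in (0 : ℝ)..(1 - 1 / Λ), (legendreP l).eval t ^ 4
      ≤ -Real.log (1 - (1 - 1 / Λ)) / l ^ 2 - -Real.log (1 - 0) / l ^ 2 := by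
    have hd (x : ℝ) (hx : x ≤ 1 - 1 / Λ) :
        HasDerivAt (fun t : ℝ => -Real.log (1 - t) / l ^ 2) (1 / (1 - x) / l ^ 2) x := by
      have h1 : HasDerivAt (fun t : ℝ => 1 - t) (-1) x := by
        simpa using (hasDerivAt_id x).const_sub 1
      refine ((h1.log (by linarith)).neg.div_const _).congr_deriv (by ring)
    refine integral_le_sub_of_hasDeriv_right_of_le (by linarith)
      (fun x hx => (hd x hx.2).continuousAt.continuousWithinAt)
      (fun x hx => (hd x hx.2.le).hasDerivWithinAt) (hcont.integrableOn_Icc) ?_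
    intro x hx
    have hx0 : 0 < x := hx.1
    have hx1 : x < 1 := by linarith [hx.2]
    have hs : 0 < 1 - x ^ 2 := by nlinarith
    have h := pow_le_pow_left₀ (by positivity) (legendreP_sq_mul_sqrt_le l hl1 hx0.le hx1) 2
    rw [mul_pow, Real.sq_sqrt hs.le, ← pow_mul, div_pow, one_pow, le_div_iff₀ (by positivity)] at h
    rw [div_div, le_div_iff₀ (mul_pos (by linarith) (by positivity))]
    refine le_trans ?_ h
    have : (1 - x) ≤ 1 - x ^ 2 := by nlinarith
    calc _ = (1 - x) * (legendreP l).eval x ^ 4 * l ^ 2 := by ring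
      _ ≤ _ := by gcongr
  have hB : ∫ t in (1 - 1 / Λ)..1, (legendreP l).eval t ^ 4 ≤ 1 - (1 - 1 / Λ) := by
    refine integral_le_sub_of_hasDeriv_right_of_le (g := fun t => t) (by linarith)
      continuousOn_id (fun x _ => (hasDerivAt_id x).hasDerivWithinAt) (hcont.integrableOn_Icc) ?_
    intro x hx
    have hx' : x ∈ Set.Icc (0 : ℝ) 1 := ⟨by linarith [hx.1], hx.2.le⟩
    have hE := legendreP_energy_le_one l hl1 hx'
    have hs : 0 ≤ 1 - x ^ 2 := by nlinarith [hx'.1, hx'.2]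
    have : 0 ≤ (1 - x ^ 2) * (derivative (legendreP l)).eval x ^ 2 / (l * (l + 1)) := by
      positivity
    have h2 : (legendreP l).eval x ^ 2 ≤ 1 := by linarith
    nlinarith [sq_nonneg ((legendreP l).eval x)]
  rw [← integral_add_adjacent_intervals (hcont.intervalIntegrable 0 (1 - 1 / Λ))
    (hcont.intervalIntegrable _ _)]
  have hlog : Real.log Λ ≤ 3 * Real.log l := by
    have h3 : Λ ≤ (l : ℝ) ^ 3 := by nlinarith
    calc Real.log Λ ≤ Real.log ((l : ℝ) ^ 3) := by gcongr
      _ = _ := by rw [Real.log_pow]; norm_num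
  have h5 : 1 / Λ ≤ 1 / (l : ℝ) ^ 2 := by gcongr
  have h6 : Real.log Λ / l ^ 2 ≤ 3 * Real.log l / l ^ 2 := by gcongr
  rw [add_div]
  simp at hA hB h5 h6 ⊢
  linarith

lemma integral_legendreP_derivative_cube_le (l : ℕ) (hl : 2 ≤ l) :
    |∫ t in (0 : ℝ)..1, t * (1 - t ^ 2) * (derivative (legendreP l)).eval t ^ 3|
      ≤ 258 * (l * (l + 1) : ℝ) := by
  have hl2 : (2 : ℝ) ≤ l := by exact_mod_cast hl
  have hl1 : 1 ≤ l := by omega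
  set Λ : ℝ := l * (l + 1) with hΛ
  have hΛ6 : l ^ 2 ≤ Λ := by nlinarith
  have hΛ1 : 4 ≤ Λ := by nlinarith
  have hinv : 0 < 1 / Λ := by positivity
  have hinv1 : 1 / Λ ≤ 1 / 4 := by gcongr
  have hinv2 : Λ * (1 / Λ) = 1 := by field_simp
  set c : ℝ := 1 - 1 / Λ with hc
  set D : ℝ → ℝ := fun t => (derivative (legendreP l)).eval t with hD
  have hcont : Continuous fun t : ℝ => |t * (1 - t ^ 2) * D t ^ 3| := by fun_prop
  have hds (x : ℝ) (hx0 : 0 ≤ x) (hx1 : x < 1) :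
      HasDerivAt (fun t : ℝ => √(1 - t ^ 2)) (-x / √(1 - x ^ 2)) x := by
    have h1 : HasDerivAt (fun t : ℝ => 1 - t ^ 2) (-(2 * x)) x := by
      simpa using (hasDerivAt_pow 2 x).const_sub 1
    refine (h1.sqrt (by nlinarith)).congr_deriv ?_
    rw [← mul_neg, mul_div_mul_left _ _ two_ne_zero]
  have habs (x : ℝ) (hx0 : 0 ≤ x) (hx1 : x < 1) :
      |x * (1 - x ^ 2) * D x ^ 3| = x * √(1 - x ^ 2) ^ 2 * |D x| ^ 3 := by
    have hs : 0 < 1 - x ^ 2 := by nlinarith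
    rw [Real.sq_sqrt hs.le, abs_mul, abs_pow, abs_of_nonneg (by positivity)]
  have hA : ∫ t in (0 : ℝ)..c, |t * (1 - t ^ 2) * D t ^ 3|
      ≤ 2 * (4 * √l) ^ 3 * (√√(1 - c ^ 2))⁻¹ - 2 * (4 * √l) ^ 3 * (√√(1 - 0 ^ 2))⁻¹ := by
    have hd (x : ℝ) (hx0 : 0 ≤ x) (hx : x ≤ c) :
        HasDerivAt (fun t : ℝ => 2 * (4 * √l) ^ 3 * (√√(1 - t ^ 2))⁻¹)
          (x * (4 * √l) ^ 3 / √√(1 - x ^ 2) ^ 5) x := by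
      have hx1 : x < 1 := by linarith
      have hs : 0 < 1 - x ^ 2 := by nlinarith
      have hw : 0 < √(1 - x ^ 2) := Real.sqrt_pos.2 hs
      have hr : 0 < √√(1 - x ^ 2) := Real.sqrt_pos.2 hw
      refine ((((hds x hx0 hx1).sqrt hw.ne').inv hr.ne').const_mul _).congr_deriv ?_
      have hwr := Real.sq_sqrt hw.le
      generalize √√(1 - x ^ 2) = r at *
      rw [← hwr]
      field_simp
    refine integral_le_sub_of_hasDeriv_right_of_le (by linarith)
      (fun x hx => (hd x hx.1 hx.2).continuousAt.continuousWithinAt)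
      (fun x hx => (hd x hx.1.le hx.2.le).hasDerivWithinAt) (hcont.integrableOn_Icc) ?_
    intro x hx
    have hx0 : 0 < x := hx.1
    have hxc : x < c := hx.2
    have hx1 : x < 1 := by linarith
    have hs : 0 < 1 - x ^ 2 := by nlinarith
    have hw : 0 < √(1 - x ^ 2) := Real.sqrt_pos.2 hs
    have hr : 0 < √√(1 - x ^ 2) := Real.sqrt_pos.2 hw
    have hwr := Real.sq_sqrt hw.le
    have hs1 : 1 / Λ ≤ 1 - x ^ 2 := by nlinarith
    have hb := legendreP_derivative_sq_le l hl1 hx0.le hx1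
      (hinv2.symm.le.trans (mul_le_mul_of_nonneg_left hs1 (by positivity)))
    rw [habs x hx0.le hx1]
    change D x ^ 2 * _ ≤ _ at hb
    generalize √√(1 - x ^ 2) = r at *
    rw [← hwr] at hb ⊢
    have hb' : |D x| * r ^ 3 ≤ 4 * √l := by
      refine le_of_sq_le_sq ?_ (by positivity)
      rw [mul_pow, sq_abs, mul_pow, Real.sq_sqrt (by positivity)]
      calc _ = D x ^ 2 * (r ^ 2) ^ 3 := by ring
        _ ≤ _ := hb
        _ = _ := by ring
    have h3 := pow_le_pow_left₀ (by positivity) hb' 3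
    rw [le_div_iff₀ (by positivity)]
    calc _ = x * (|D x| * r ^ 3) ^ 3 := by ring
      _ ≤ _ := by gcongr
  have hB : ∫ t in c..1, |t * (1 - t ^ 2) * D t ^ 3|
      ≤ -√Λ ^ 3 * √(1 - 1 ^ 2) - -√Λ ^ 3 * √(1 - c ^ 2) := by
    have hc0 : 0 < c := by linarith
    refine integral_le_sub_of_hasDeriv_right_of_le
      (g := fun t => -√Λ ^ 3 * √(1 - t ^ 2))
      (g' := fun x => -√Λ ^ 3 * (-x / √(1 - x ^ 2))) (by linarith)
      (by fun_prop) (fun x hx => ((hds x (hc0.trans hx.1).le hx.2).const_mul _).hasDerivWithinAt)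
      (hcont.integrableOn_Icc) ?_
    intro x hx
    have hx0 : 0 < x := hc0.trans hx.1
    have hx1 : x < 1 := hx.2
    have hs : 0 < 1 - x ^ 2 := by nlinarith
    have hw : 0 < √(1 - x ^ 2) := Real.sqrt_pos.2 hs
    have hE := legendreP_energy_le_one l hl1 ⟨hx0.le, hx1.le⟩
    have hE2 : (1 - x ^ 2) * D x ^ 2 / Λ ≤ 1 := by
      refine le_trans ?_ hE
      exact le_add_of_nonneg_left (sq_nonneg _)
    rw [div_le_one (by positivity)] at hE2
    have hb' : √(1 - x ^ 2) * |D x| ≤ √Λ := by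
      refine le_of_sq_le_sq ?_ (by positivity)
      rw [mul_pow, sq_abs, Real.sq_sqrt hs.le, Real.sq_sqrt (by positivity)]
      exact hE2
    have h3 := pow_le_pow_left₀ (by positivity) hb' 3
    rw [habs x hx0.le hx1]
    have : -√Λ ^ 3 * (-x / √(1 - x ^ 2)) = x * √Λ ^ 3 / √(1 - x ^ 2) := by ring
    rw [this, le_div_iff₀ hw]
    calc _ = x * (√(1 - x ^ 2) * |D x|) ^ 3 := by ring
      _ ≤ _ := by gcongr
  have hsc : 1 / Λ ≤ 1 - c ^ 2 := by nlinarith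
  have hsc2 : 1 - c ^ 2 ≤ 2 * (1 / Λ) := by nlinarith
  have hs0 : 0 < 1 - c ^ 2 := hinv.trans_le hsc
  have hA' : 2 * (4 * √l) ^ 3 * (√√(1 - c ^ 2))⁻¹ ≤ 256 * Λ := by
    have hr : (√√(1 - c ^ 2))⁻¹ ≤ 2 * √l := by
      have hw : 0 < √(1 - c ^ 2) := Real.sqrt_pos.2 hs0
      have hr : 0 < √√(1 - c ^ 2) := Real.sqrt_pos.2 hw
      refine le_of_pow_le_pow_left₀ (n := 4) (by norm_num) (by positivity) ?_
      have e1 : √√(1 - c ^ 2) ^ 4 = 1 - c ^ 2 := by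
        rw [show 4 = 2 * 2 by norm_num, pow_mul, Real.sq_sqrt hw.le, Real.sq_sqrt hs0.le]
      have e2 : (2 * √l) ^ 4 = 16 * (l : ℝ) ^ 2 := by
        rw [mul_pow, show 4 = 2 * 2 by norm_num, pow_mul (√(l : ℝ)), Real.sq_sqrt (by positivity)]
        norm_num
      rw [inv_pow, e1, e2]
      calc (1 - c ^ 2)⁻¹ ≤ (1 / Λ)⁻¹ := by gcongr
        _ = Λ := by simp
        _ ≤ _ := by nlinarith
    calc _ ≤ 2 * (4 * √l) ^ 3 * (2 * √l) := by gcongr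
      _ = 256 * (√l ^ 2) ^ 2 := by ring
      _ = 256 * l ^ 2 := by rw [Real.sq_sqrt (by positivity)]
      _ ≤ _ := by gcongr
  have hB' : √Λ ^ 3 * √(1 - c ^ 2) ≤ 2 * Λ := by
    have e : √Λ * √(1 - c ^ 2) ≤ 2 := by
      rw [← Real.sqrt_mul (by positivity), Real.sqrt_le_left (by norm_num)]
      nlinarith
    calc _ = √Λ ^ 2 * (√Λ * √(1 - c ^ 2)) := by ring
      _ = Λ * (√Λ * √(1 - c ^ 2)) := by rw [Real.sq_sqrt (by positivity)]
      _ ≤ Λ * 2 := by gcongr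
      _ = _ := by ring
  refine (intervalIntegral.abs_integral_le_integral_abs zero_le_one).trans ?_
  change ∫ t in (0 : ℝ)..1, |t * (1 - t ^ 2) * D t ^ 3| ≤ _
  rw [← integral_add_adjacent_intervals (hcont.intervalIntegrable 0 c)
    (hcont.intervalIntegrable _ _)]
  have : (0 : ℝ) ≤ 2 * (4 * √l) ^ 3 * (√√(1 - 0 ^ 2))⁻¹ := by positivity
  have h0 : √((1 : ℝ) - 1 ^ 2) = 0 := by simp
  rw [h0] at hB
  linarith

/-- The Legendre equation makes `P³` a derivative up to a cubic term in the derivative of `P`. -/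
lemma integral_legendreP_cube (l : ℕ) (hl : 1 ≤ l) :
    ∫ t in (0 : ℝ)..1, (legendreP l).eval t ^ 3
      = 2 / (3 * (l * (l + 1)) ^ 2) * (derivative (legendreP l)).eval 0 ^ 3
        + 4 / (3 * (l * (l + 1)) ^ 2)
          * ∫ t in (0 : ℝ)..1, t * (1 - t ^ 2) * (derivative (legendreP l)).eval t ^ 3 := by
  have hl0 : (0 : ℝ) < l := by exact_mod_cast hl
  have hd (x : ℝ) : HasDerivAt (fun t => -(1 / (l * (l + 1)) : ℝ) *
      ((1 - t ^ 2) * (derivative (legendreP l)).eval t * (legendreP l).eval t ^ 2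
        + 2 / (3 * (l * (l + 1))) * ((1 - t ^ 2) ^ 2 * (derivative (legendreP l)).eval t ^ 3)))
      ((legendreP l).eval x ^ 3 - 4 / (3 * (l * (l + 1)) ^ 2)
        * (x * (1 - x ^ 2) * (derivative (legendreP l)).eval x ^ 3)) x := by
    have h1 : HasDerivAt (fun t : ℝ => 1 - t ^ 2) (-(2 * x)) x := by
      simpa using (hasDerivAt_pow 2 x).const_sub 1
    have hp := (legendreP l).hasDerivAt x
    have hp' := (derivative (legendreP l)).hasDerivAt x
    refine ((((h1.mul hp').mul (hp.pow 2)).add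
      (((h1.pow 2).mul (hp'.pow 3)).const_mul _)).const_mul _).congr_deriv ?_
    have ho := legendreP_ode l x
    simp
    generalize eval x (derivative (derivative (legendreP l))) = d2 at *
    generalize (derivative (legendreP l)).eval x = d at *
    generalize (legendreP l).eval x = p at *
    field_simp
    linear_combination (-3 * l * (l + 1) * p ^ 2 - 6 * (1 - x ^ 2) * d ^ 2) * ho
  have hint := integral_eq_sub_of_hasDerivAt (a := 0) (b := 1) (fun x _ => hd x)
    (Continuous.intervalIntegrable (by fun_prop) _ _)
  rw [intervalIntegral.integral_sub (Continuous.intervalIntegrable (by fun_prop) _ _)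
    (Continuous.intervalIntegrable (by fun_prop) _ _), intervalIntegral.integral_const_mul] at hint
  have hz := (legendreP_energy_zero l hl).1
  rw [sub_eq_iff_eq_add] at hint
  rw [hint]
  congr 1
  norm_num
  field_simp
  linear_combination 3 * l * (l + 1) * (legendreP l).eval 0 * hz

lemma abs_integral_legendreP_cube_le (l : ℕ) (hl : 2 ≤ l) :
    |∫ t in (0 : ℝ)..1, (legendreP l).eval t ^ 3| ≤ 346 / (l : ℝ) ^ 2 := by
  have hl2 : (2 : ℝ) ≤ l := by exact_mod_cast hl
  have hI := integral_legendreP_derivative_cube_le l hl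
  have hE := (legendreP_energy_zero l (by omega)).2
  rw [integral_legendreP_cube l (by omega)]
  generalize (∫ t in (0 : ℝ)..1, t * (1 - t ^ 2) * (derivative (legendreP l)).eval t ^ 3) = I at *
  generalize (derivative (legendreP l)).eval 0 = d at *
  have hd : d ^ 2 ≤ l + 1 := by
    have : d ^ 2 / (l * (l + 1)) ≤ 1 / l := by nlinarith [sq_nonneg ((legendreP l).eval 0)]
    rw [div_le_div_iff₀ (by positivity) (by positivity)] at this
    nlinarith
  have hd1 : |d| ≤ l + 1 := abs_le_of_sq_le_sq (by nlinarith) (by linarith)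
  have hd3 : |d ^ 3| ≤ 2 * (l * (l + 1)) := by
    rw [abs_pow, pow_succ, sq_abs]
    calc d ^ 2 * |d| ≤ (l + 1) * (l + 1) := by gcongr
      _ ≤ _ := by nlinarith
  refine (abs_add_le _ _).trans ?_
  rw [abs_mul, abs_mul, abs_of_nonneg (by positivity : (0 : ℝ) ≤ 2 / (3 * (l * (l + 1)) ^ 2)),
    abs_of_nonneg (by positivity : (0 : ℝ) ≤ 4 / (3 * (l * (l + 1)) ^ 2))]
  calc _ ≤ 2 / (3 * (l * (l + 1)) ^ 2) * (2 * (l * (l + 1)))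
        + 4 / (3 * (l * (l + 1)) ^ 2) * (258 * (l * (l + 1) : ℝ)) := by gcongr
    _ = (1036 / 3) / (l * (l + 1)) := by field_simp; norm_num
    _ ≤ 346 / l ^ 2 := by gcongr <;> nlinarith

/-- uniformly in `q ≥ 3`, `|∫_0^1 P_l(t)^q dt| ≤ C log l / l²` for `l ≥ 2`. -/
theorem legendre_moments_bound :
    ∃ C > (0:ℝ), ∀ q : ℕ, 3 ≤ q → ∀ l : ℕ, 2 ≤ l →
      |∫ t in (0:ℝ)..1, (legendreP l).eval t ^ q| ≤ C * Real.log l / (l : ℝ) ^ 2 := by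
  refine ⟨692, by norm_num, fun q hq l hl => ?_⟩
  have hl2 : (2 : ℝ) ≤ l := by exact_mod_cast hl
  have hlog : 1 / 2 ≤ Real.log l := by
    have := Real.log_two_gt_d9
    have := Real.log_le_log (by norm_num) hl2
    linarith
  obtain rfl | hq4 := hq.eq_or_lt
  · refine (abs_integral_legendreP_cube_le l hl).trans ?_
    gcongr
    linarith
  · calc |∫ t in (0:ℝ)..1, (legendreP l).eval t ^ q|
        ≤ ∫ t in (0:ℝ)..1, |(legendreP l).eval t ^ q| :=
          intervalIntegral.abs_integral_le_integral_abs zero_le_one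
      _ ≤ ∫ t in (0:ℝ)..1, (legendreP l).eval t ^ 4 := by
          refine integral_mono_on zero_le_one (Continuous.intervalIntegrable (by fun_prop) _ _)
            (Continuous.intervalIntegrable (by fun_prop) _ _) fun x hx => ?_
          have hE := legendreP_energy_le_one l (by omega) hx
          have hs : 0 ≤ 1 - x ^ 2 := by nlinarith [hx.1, hx.2]
          have : 0 ≤ (1 - x ^ 2) * (derivative (legendreP l)).eval x ^ 2 / (l * (l + 1)) := by
            positivity
          have h1 : |(legendreP l).eval x| ≤ 1 := abs_le_of_sq_le_sq (by linarith) zero_le_one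
          rw [abs_pow, ← Even.pow_abs (by decide : Even 4)]
          exact pow_le_pow_of_le_one (abs_nonneg _) h1 hq4
      _ ≤ (3 * Real.log l + 1) / (l : ℝ) ^ 2 := integral_legendreP_pow_four_le l hl
      _ ≤ _ := by
          gcongr
          linarith
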